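/- Let n ≥ 2 and 0 < r < R. There exists a constant C > 0 such that for every integer N ≥ 1 there is a C^∞ function φ : ℝ^n → ℝ which is radial (φ(x) = g(‖x‖) for some g : ℝ → ℝ), satisfies 0 ≤ φ ≤ 1 everywhere, φ = 1 on the closed ball of radius r centered at 0, φ = 0 outside the open ball of radius R centered at 0, and for every integer m with 1 ≤ m ≤ 3N and every x ∈ ℝ^n, the norm of the m-th iterated (Fréchet) derivative of φ at x is at most C^{m+1} N^m. In particular φ is constant on each sphere ‖x‖ = const, i.e., on the integral manifolds of the angular vector fields x_i∂_j − x_j∂_i. -/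

import Mathlib

open MeasureTheory Metric Module Submodule

section Mollification

variable {E G : Type*} [NormedAddCommGroup E] [InnerProductSpace ℝ E] [FiniteDimensional ℝ E]
  [MeasurableSpace E] [BorelSpace E] [NormedAddCommGroup G] [NormedSpace ℝ G]

/-- The convolution of a scalar kernel `ψ` with a vector-valued function `F`. -/
noncomputable def mollify (ψ : E → ℝ) (F : E → G) (x : E) : G := ∫ t, ψ t • F (x - t)

theorem mollify_eq_convolution (ψ : E → ℝ) (F : E → G) :
    mollify ψ F = convolution ψ F (ContinuousLinearMap.lsmul ℝ ℝ) volume := rfl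

theorem hasFDerivAt_mollify {ψ : E → ℝ} {F : E → G} (hψ : Continuous ψ)
    (hF : ContDiff ℝ 1 F) (hFc : HasCompactSupport F) (x : E) :
    HasFDerivAt (mollify ψ F) (mollify ψ (fderiv ℝ F) x) x :=
  hFc.hasFDerivAt_convolution_right (ContinuousLinearMap.lsmul ℝ ℝ)
    (hψ.locallyIntegrable (μ := volume)) hF x

theorem contDiff_mollify {ψ : E → ℝ} {F : E → G} (hψ : Continuous ψ)
    (hF : ContDiff ℝ (⊤ : ℕ∞) F) (hFc : HasCompactSupport F) :
    ContDiff ℝ (⊤ : ℕ∞) (mollify ψ F) :=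
  hFc.contDiff_convolution_right (ContinuousLinearMap.lsmul ℝ ℝ)
    (hψ.locallyIntegrable (μ := volume)) hF

theorem LinearIsometryEquiv.comp_mollify {H : Type*} [NormedAddCommGroup H] [NormedSpace ℝ H]
    (L : G ≃ₗᵢ[ℝ] H) (ψ : E → ℝ) (F : E → G) :
    L ∘ mollify ψ F = mollify ψ (L ∘ F) := by
  ext x
  have := L.toContinuousLinearEquiv.integral_comp_comm (μ := volume)
    (fun t => ψ t • F (x - t))
  simpa [mollify] using this.symm

theorem iteratedFDeriv_mollify {ψ : E → ℝ} {F : E → G} (hψ : Continuous ψ)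
    (hF : ContDiff ℝ (⊤ : ℕ∞) F) (hFc : HasCompactSupport F) (m : ℕ) :
    iteratedFDeriv ℝ m (mollify ψ F) = mollify ψ (iteratedFDeriv ℝ m F) := by
  induction m with
  | zero => rw [iteratedFDeriv_zero_eq_comp, iteratedFDeriv_zero_eq_comp,
      LinearIsometryEquiv.comp_mollify]
  | succ m ih =>
    have hd : fderiv ℝ (mollify ψ (iteratedFDeriv ℝ m F)) =
        mollify ψ (fderiv ℝ (iteratedFDeriv ℝ m F)) := funext fun x =>
      (hasFDerivAt_mollify hψ (hF.iteratedFDeriv_right (mod_cast le_top))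
        (hFc.iteratedFDeriv m) x).fderiv
    rw [iteratedFDeriv_succ_eq_comp_left, iteratedFDeriv_succ_eq_comp_left, ih, hd]
    exact LinearIsometryEquiv.comp_mollify (G := E →L[ℝ] E [×m]→L[ℝ] G)
      (H := E [×(m + 1)]→L[ℝ] G) (continuousMultilinearCurryLeftEquiv ℝ (fun _ : Fin (m + 1) => E) G).symm ψ _

/-- A continuous radial probability density supported in the ball of radius `ε`, whose
translates depend on the translation parameter in an `L`-Lipschitz way for the `L¹` norm. -/
structure IsRadialKernel (ψ : E → ℝ) (ε L : ℝ) : Prop where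
  continuous : Continuous ψ
  hasCompactSupport : HasCompactSupport ψ
  nonneg : ∀ t, 0 ≤ ψ t
  integral_eq_one : ∫ t, ψ t = 1
  comp_isometry : ∀ (A : E ≃ₗᵢ[ℝ] E) (t : E), ψ (A t) = ψ t
  eq_zero : ∀ t, ε ≤ ‖t‖ → ψ t = 0
  lipschitz : ∀ x y, ∫ t, |ψ (x - t) - ψ (y - t)| ≤ L * ‖x - y‖

theorem exists_isRadialKernel {ε : ℝ} (hε : 0 < ε) :
    ∃ ψ : E → ℝ, IsRadialKernel ψ ε (2 ^ (finrank ℝ E + 2) / ε) := by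
  set τ : E → ℝ := fun t => max (ε - ‖t‖) 0 with hτ
  have hτc : Continuous τ := by fun_prop
  have hτ0 : ∀ t, 0 ≤ τ t := fun t => le_max_right _ _
  have hτz : ∀ t, ε ≤ ‖t‖ → τ t = 0 := fun t ht => max_eq_right (by linarith)
  have hτs : HasCompactSupport τ := by
    refine HasCompactSupport.intro (isCompact_closedBall (0 : E) ε) fun t ht => hτz t ?_
    simp only [mem_closedBall, dist_zero_right, not_le] at ht
    exact ht.le
  have hτi : Integrable τ := hτc.integrable_of_hasCompactSupport hτs
  have hτl : ∀ x y, |τ x - τ y| ≤ ‖x - y‖ := fun x y => by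
    refine (abs_max_sub_max_le_abs _ _ 0).trans ?_
    rw [sub_sub_sub_cancel_left, abs_sub_comm]
    exact abs_norm_sub_norm_le x y
  set V : ℝ := volume.real (ball (0 : E) (ε / 2)) with hV
  have hVpos : 0 < V := ENNReal.toReal_pos
    (measure_ball_pos _ _ (by positivity)).ne' measure_ball_lt_top.ne
  have hV2 : ∀ x : E, volume.real (ball x ε) = 2 ^ finrank ℝ E * V := fun x => by
    have := Measure.addHaar_ball_mul_of_pos (volume : Measure E) x two_pos (ε / 2)
    rw [mul_div_cancel₀ _ two_ne_zero] at this
    rw [hV, measureReal_def, this, ENNReal.toReal_mul, ENNReal.toReal_ofReal (by positivity),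
      measureReal_def]
  have hint : ε / 2 * V ≤ ∫ t, τ t := by
    calc ε / 2 * V = ∫ _ in ball (0 : E) (ε / 2), ε / 2 := by
          rw [setIntegral_const, smul_eq_mul, mul_comm]
      _ ≤ ∫ t in ball (0 : E) (ε / 2), τ t := by
          refine setIntegral_mono_on (integrableOn_const measure_ball_lt_top.ne)
            hτi.integrableOn measurableSet_ball fun t ht => ?_
          rw [mem_ball_zero_iff] at ht
          exact le_max_of_le_left (by linarith)
      _ ≤ ∫ t, τ t := setIntegral_le_integral hτi (.of_forall hτ0)
  have hpos : 0 < ∫ t, τ t := lt_of_lt_of_le (by positivity) hint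
  have hlip : ∀ x y, ∫ t, |τ (x - t) - τ (y - t)| ≤ 2 ^ (finrank ℝ E + 1) * V * ‖x - y‖ := by
    intro x y
    have hz : ∀ t ∉ ball x ε ∪ ball y ε, |τ (x - t) - τ (y - t)| = 0 := by
      intro t ht
      simp only [Set.mem_union, mem_ball, not_or, not_lt] at ht
      rw [hτz (x - t) (by rw [← dist_eq_norm, dist_comm]; exact ht.1),
        hτz (y - t) (by rw [← dist_eq_norm, dist_comm]; exact ht.2)]
      simp
    rw [← setIntegral_eq_integral_of_forall_compl_eq_zero hz]
    have hfin : volume (ball x ε ∪ ball y ε) < ⊤ :=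
      measure_union_lt_top measure_ball_lt_top measure_ball_lt_top
    have h1 := norm_setIntegral_le_of_norm_le_const (μ := volume) (C := ‖x - y‖) hfin
      (f := fun t => |τ (x - t) - τ (y - t)|) fun t _ => by
        simpa using hτl (x - t) (y - t)
    have h2 : volume.real (ball x ε ∪ ball y ε) ≤ 2 ^ (finrank ℝ E + 1) * V := by
      refine (measureReal_union_le _ _).trans_eq ?_
      rw [hV2, hV2]; ring
    calc _ ≤ ‖x - y‖ * volume.real (ball x ε ∪ ball y ε) := (le_abs_self _).trans h1
      _ ≤ ‖x - y‖ * (2 ^ (finrank ℝ E + 1) * V) := by gcongr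
      _ = _ := mul_comm _ _
  refine ⟨fun t => (∫ s, τ s)⁻¹ * τ t, ?_, ?_, ?_, ?_, ?_, ?_, ?_⟩
  · fun_prop
  · exact hτs.mul_left
  · exact fun t => mul_nonneg (inv_nonneg.2 hpos.le) (hτ0 t)
  · rw [integral_const_mul, inv_mul_cancel₀ hpos.ne']
  · intro A t
    simp [hτ]
  · intro t ht
    simp [hτz t ht]
  · intro x y
    simp_rw [← mul_sub, abs_mul, abs_of_pos (inv_pos.2 hpos)]
    rw [integral_const_mul]
    calc (∫ s, τ s)⁻¹ * ∫ t, |τ (x - t) - τ (y - t)|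
        ≤ (ε / 2 * V)⁻¹ * (2 ^ (finrank ℝ E + 1) * V * ‖x - y‖) := by
          gcongr
          exact hlip x y
      _ = _ := by field_simp; ring

namespace IsRadialKernel

variable {ψ : E → ℝ} {ε L : ℝ} (h : IsRadialKernel ψ ε L)
include h

theorem integrable : Integrable ψ :=
  h.continuous.integrable_of_hasCompactSupport h.hasCompactSupport

theorem norm_mollify_le {F : E → G} {M : ℝ} (hM : ∀ x, ‖F x‖ ≤ M) (x : E) :
    ‖mollify ψ F x‖ ≤ M := by
  refine (norm_integral_le_of_norm_le (h.integrable.mul_const M) (.of_forall fun t => ?_)).trans_eq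
    (by rw [integral_mul_const, h.integral_eq_one, one_mul])
  rw [norm_smul, Real.norm_of_nonneg (h.nonneg t)]
  exact mul_le_mul_of_nonneg_left (hM _) (h.nonneg t)

theorem integrable_mollify {F : E → G} (hF : Continuous F) (x : E) :
    Integrable fun t => ψ t • F (x - t) :=
  Continuous.integrable_of_hasCompactSupport
    (h.continuous.smul (by fun_prop)) h.hasCompactSupport.smul_right

theorem norm_mollify_sub_le {F : E → G} (hF : Continuous F) {M : ℝ} (hM : ∀ x, ‖F x‖ ≤ M)
    (x y : E) : ‖mollify ψ F x - mollify ψ F y‖ ≤ L * M * ‖x - y‖ := by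
  have hM0 : 0 ≤ M := (norm_nonneg _).trans (hM 0)
  have hψ : ∀ z, Integrable fun t => ψ (z - t) := fun z => h.integrable.comp_sub_left z
  have hi : ∀ z, Integrable fun t => ψ (z - t) • F t := fun z => by
    simpa using (h.integrable_mollify hF z).comp_sub_left z
  have he : ∀ z, mollify ψ F z = ∫ t, ψ (z - t) • F t := fun z => by
    rw [mollify, ← integral_sub_left_eq_self _ volume z]
    simp
  rw [he, he, ← integral_sub (hi x) (hi y)]
  refine (norm_integral_le_of_norm_le (((hψ x).sub (hψ y)).abs.mul_const M)
    (.of_forall fun t => ?_)).trans ?_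
  · rw [← sub_smul, norm_smul]
    exact mul_le_mul_of_nonneg_left (hM _) (norm_nonneg _)
  · rw [integral_mul_const]
    calc _ ≤ L * ‖x - y‖ * M := mul_le_mul_of_nonneg_right (h.lipschitz x y) hM0
      _ = _ := by ring

end IsRadialKernel

/-- A smooth function with values in `[0, 1]`, invariant under linear isometries, equal to `1`
on the ball of radius `a`, to `0` off the ball of radius `b`, and whose derivatives of order
`m ≤ k` are bounded by `L ^ m`. -/
structure IsRadialCutoff (f : E → ℝ) (a b L : ℝ) (k : ℕ) : Prop where
  contDiff : ContDiff ℝ (⊤ : ℕ∞) f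
  comp_isometry : ∀ (A : E ≃ₗᵢ[ℝ] E) (x : E), f (A x) = f x
  nonneg : ∀ x, 0 ≤ f x
  le_one : ∀ x, f x ≤ 1
  eq_one : ∀ x, ‖x‖ ≤ a → f x = 1
  eq_zero : ∀ x, b ≤ ‖x‖ → f x = 0
  norm_iteratedFDeriv_le : ∀ m ≤ k, ∀ x, ‖iteratedFDeriv ℝ m f x‖ ≤ L ^ m

namespace IsRadialCutoff

variable {f ψ : E → ℝ} {a b L ε : ℝ} {k : ℕ}

omit [MeasurableSpace E] [BorelSpace E] in
theorem hasCompactSupport (hf : IsRadialCutoff f a b L k) : HasCompactSupport f := by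
  refine HasCompactSupport.intro (isCompact_closedBall (0 : E) b) fun t ht => hf.eq_zero t ?_
  simp only [mem_closedBall, dist_zero_right, not_le] at ht
  exact ht.le

theorem mollify (hf : IsRadialCutoff f a b L k) (hψ : IsRadialKernel ψ ε L) (hL : 0 ≤ L) :
    IsRadialCutoff (mollify ψ f) (a - ε) (b + ε) L (k + 1) where
  contDiff := contDiff_mollify hψ.continuous hf.contDiff hf.hasCompactSupport
  comp_isometry A x := by
    have := A.measurePreserving.integral_comp' (f := A.toMeasurableEquiv)
      (fun t => ψ t • f (A x - t))
    simp only [_root_.mollify]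
    rw [← this]
    simp [← map_sub, hf.comp_isometry, hψ.comp_isometry]
  nonneg x := integral_nonneg fun t => mul_nonneg (hψ.nonneg t) (hf.nonneg _)
  le_one x := (le_abs_self _).trans <| hψ.norm_mollify_le (fun y => by
    rw [Real.norm_of_nonneg (hf.nonneg y)]; exact hf.le_one y) x
  eq_one x hx := by
    rw [_root_.mollify, ← hψ.integral_eq_one]
    congr 1 with t
    rcases le_or_gt ε ‖t‖ with ht | ht
    · simp [hψ.eq_zero t ht]
    · rw [hf.eq_one, smul_eq_mul, mul_one]
      linarith [norm_sub_le x t]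
  eq_zero x hx := by
    rw [_root_.mollify, ← integral_zero E ℝ]
    congr 1 with t
    rcases le_or_gt ε ‖t‖ with ht | ht
    · simp [hψ.eq_zero t ht]
    · rw [hf.eq_zero, smul_zero]
      linarith [norm_sub_norm_le x t]
  norm_iteratedFDeriv_le m hm x := by
    rcases m with _ | m
    · rw [iteratedFDeriv_mollify hψ.continuous hf.contDiff hf.hasCompactSupport]
      exact hψ.norm_mollify_le (hf.norm_iteratedFDeriv_le 0 (Nat.zero_le _)) x
    · rw [← norm_fderiv_iteratedFDeriv,
        iteratedFDeriv_mollify hψ.continuous hf.contDiff hf.hasCompactSupport, pow_succ']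
      exact norm_fderiv_le_of_lip' ℝ (by positivity) <| .of_forall fun y =>
        hψ.norm_mollify_sub_le
          (hf.contDiff.continuous_iteratedFDeriv (mod_cast le_top))
          (hf.norm_iteratedFDeriv_le m (by omega)) y x

omit [FiniteDimensional ℝ E] [MeasurableSpace E] [BorelSpace E] in
theorem eq_comp_norm (hf : IsRadialCutoff f a b L k) : ∃ g : ℝ → ℝ, ∀ x, f x = g ‖x‖ := by
  have : Function.FactorsThrough f (norm : E → ℝ) := fun x y hxy => by
    rw [← reflection_sub hxy, hf.comp_isometry]
  obtain ⟨g, hg⟩ := (Function.factorsThrough_iff f).1 this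
  exact ⟨g, congrFun hg⟩

end IsRadialCutoff

omit [FiniteDimensional ℝ E] [MeasurableSpace E] [BorelSpace E] in
theorem exists_isRadialCutoff_zero {a b : ℝ} (ha : 0 ≤ a) (hab : a < b) (L : ℝ) :
    ∃ f : E → ℝ, IsRadialCutoff f a b L 0 := by
  have hd : 0 < b ^ 2 - a ^ 2 := by nlinarith
  refine ⟨fun x => Real.smoothTransition ((b ^ 2 - ‖x‖ ^ 2) / (b ^ 2 - a ^ 2)), ?_, ?_,
    fun x => Real.smoothTransition.nonneg _, fun x => Real.smoothTransition.le_one _, ?_, ?_, ?_⟩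
  · exact Real.smoothTransition.contDiff.comp
      ((contDiff_const.sub (contDiff_norm_sq ℝ)).div_const _)
  · intro A x
    simp
  · intro x hx
    refine Real.smoothTransition.one_of_one_le ?_
    rw [one_le_div hd]
    gcongr
  · intro x hx
    refine Real.smoothTransition.zero_of_nonpos (div_nonpos_of_nonpos_of_nonneg ?_ hd.le)
    have : b ^ 2 ≤ ‖x‖ ^ 2 := by gcongr; linarith
    linarith
  · intro m hm x
    obtain rfl := Nat.le_zero.1 hm
    rw [norm_iteratedFDeriv_zero, pow_zero, Real.norm_of_nonneg (Real.smoothTransition.nonneg _)]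
    exact Real.smoothTransition.le_one _

theorem exists_isRadialCutoff {a b ε : ℝ} (ha : 0 ≤ a) (hab : a < b) (hε : 0 < ε) (k : ℕ) :
    ∃ f : E → ℝ,
      IsRadialCutoff f (a - k * ε) (b + k * ε) (2 ^ (finrank ℝ E + 2) / ε) k := by
  induction k with
  | zero => simpa using exists_isRadialCutoff_zero ha hab _
  | succ k ih =>
    obtain ⟨f, hf⟩ := ih
    obtain ⟨ψ, hψ⟩ := exists_isRadialKernel (E := E) hε
    refine ⟨mollify ψ f, ?_⟩
    convert hf.mollify hψ (by positivity) using 1 <;> push_cast <;> ring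

end Mollification


/-- Existence of radial Ehrenpreis-type localizing functions: cut-off functions `φ_N`,
radial (hence constant on the integral manifolds of the angular vector fields
`x_i∂_j − x_j∂_i`), identically `1` on the closed ball of radius `r`, vanishing
outside the open ball of radius `R`, with `‖D^m φ_N‖ ≤ C^{m+1} N^m` for
`1 ≤ m ≤ 3N`, where `C` depends only on `n, r, R`. -/
theorem radial_ehrenpreis_cutoffs (n : ℕ) (hn : 2 ≤ n) (r R : ℝ) (hr : 0 < r)
    (hrR : r < R) :
    ∃ C : ℝ, 0 < C ∧ ∀ N : ℕ, 1 ≤ N →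
      ∃ φ : EuclideanSpace ℝ (Fin n) → ℝ,
        ContDiff ℝ (⊤ : ℕ∞) φ ∧
        (∃ g : ℝ → ℝ, ∀ x, φ x = g ‖x‖) ∧
        (∀ x, 0 ≤ φ x ∧ φ x ≤ 1) ∧
        (∀ x ∈ Metric.closedBall (0 : EuclideanSpace ℝ (Fin n)) r, φ x = 1) ∧
        (∀ x ∉ Metric.ball (0 : EuclideanSpace ℝ (Fin n)) R, φ x = 0) ∧
        (∀ m : ℕ, 1 ≤ m → m ≤ 3 * N →
          ∀ x, ‖iteratedFDeriv ℝ m φ x‖ ≤ C ^ (m + 1) * (N : ℝ) ^ m) := by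
  set K : ℝ := 2 ^ (n + 2) * 9 / (R - r) with hK
  have hd : 0 < R - r := sub_pos.2 hrR
  have hK0 : 0 < K := by positivity
  refine ⟨max 1 K, by positivity, fun N hN => ?_⟩
  have hN0 : (0 : ℝ) < N := by exact_mod_cast hN
  obtain ⟨f, hf⟩ := exists_isRadialCutoff (E := EuclideanSpace ℝ (Fin n))
    (a := r + (R - r) / 3) (b := R - (R - r) / 3) (ε := (R - r) / (9 * N))
    (by linarith) (by linarith) (by positivity) (3 * N)
  have hshift : ((3 * N : ℕ) : ℝ) * ((R - r) / (9 * N)) = (R - r) / 3 := by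
    push_cast
    field_simp
    norm_num
  rw [hshift, finrank_euclideanSpace_fin, add_sub_cancel_right, sub_add_cancel] at hf
  refine ⟨f, hf.contDiff, hf.eq_comp_norm, fun x => ⟨hf.nonneg x, hf.le_one x⟩,
    fun x hx => hf.eq_one x (mem_closedBall_zero_iff.1 hx),
    fun x hx => hf.eq_zero x (not_lt.1 (mt mem_ball_zero_iff.2 hx)), fun m _ hm x => ?_⟩
  calc ‖iteratedFDeriv ℝ m f x‖ ≤ (2 ^ (n + 2) / ((R - r) / (9 * N))) ^ m :=
        hf.norm_iteratedFDeriv_le m hm x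
    _ = K ^ m * N ^ m := by
        rw [← mul_pow, hK]
        congr 1
        field_simp
    _ ≤ max 1 K ^ (m + 1) * N ^ m := by
        gcongr
        calc K ^ m ≤ max 1 K ^ m := by gcongr; exact le_max_right _ _
          _ ≤ max 1 K ^ (m + 1) := pow_le_pow_right₀ (le_max_left _ _) m.le_succ
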